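/- Barrier supersolution inequality: Let n ≥ 1, p ∈ (1,∞), 0 ≤ 𝔭 ≤ 𝔮 < ∞, let 𝔞 : Q₁ → ℝ satisfy 0 ≤ 𝔞(x,t) ≤ 𝔞⁺ < ∞, and let 𝔠₀ < 0. Set α := 1/(1+𝔭), so that θ := 2 − 𝔭α satisfies (1+α)/θ = 1, and for 𝔠 ∈ (0,1] define Φ(x,t) := 𝔠(|x|^{1+α} − t). If in addition 𝔠 ≤ |𝔠₀|/(1 + 2^{1+𝔮}(1 + 𝔞⁺)(n − 1 + α(p−1))), then for every point (x,t) with 0 < |x| ≤ 1 and t < 0 the classical derivatives of Φ satisfy ∂ₜΦ(x,t) − ℋ(x,t,∇Φ(x,t)) Δ_p^N Φ(x,t) ≥ 𝔠₀, where ∇Φ(x,t) = 𝔠(1+α)|x|^{α−1}x ≠ 0 and Δ_p^N Φ(x,t) = 𝔠(1+α)|x|^{α−1}(n − 1 + α(p−1)). -/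

import Mathlib

open Set Metric Filter MeasureTheory

noncomputable section

/-- `n`-dimensional Euclidean space. -/
abbrev Euc (n : ℕ) := EuclideanSpace ℝ (Fin n)

/-- Standard parabolic cylinder `B_r × (-r², 0]` centered at the origin. -/
def Qcyl (n : ℕ) (r : ℝ) : Set (Euc n × ℝ) :=
  {z | ‖z.1‖ < r ∧ -(r ^ 2) < z.2 ∧ z.2 ≤ 0}

/-- Intrinsic parabolic cylinder `B_r × (-r² λ^{-𝔭}, 0]`. -/
def QcylIntr (n : ℕ) (r lam pp : ℝ) : Set (Euc n × ℝ) :=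
  {z | ‖z.1‖ < r ∧ -(r ^ 2 * lam ^ (-pp)) < z.2 ∧ z.2 ≤ 0}

/-- The θ-parabolic cylinder `B_r(x₀) × (t₀ - r^θ, t₀]`. -/
def QcylTheta (n : ℕ) (r θ : ℝ) (x₀ : Euc n) (t₀ : ℝ) : Set (Euc n × ℝ) :=
  {z | ‖z.1 - x₀‖ < r ∧ t₀ - r ^ θ < z.2 ∧ z.2 ≤ t₀}

/-- Parabolic boundary of the θ-parabolic cylinder. -/
def parBdryTheta (n : ℕ) (r θ : ℝ) (x₀ : Euc n) (t₀ : ℝ) : Set (Euc n × ℝ) :=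
  {z | ‖z.1 - x₀‖ = r ∧ t₀ - r ^ θ ≤ z.2 ∧ z.2 < t₀} ∪
    {z | ‖z.1 - x₀‖ < r ∧ z.2 = t₀ - r ^ θ}

/-- The spatial gradient of a space-time function. -/
def sgrad {n : ℕ} (u : Euc n × ℝ → ℝ) (x : Euc n) (t : ℝ) : Euc n :=
  gradient (fun y => u (y, t)) x

/-- The spatial Hessian, as a continuous linear operator. -/
def hessOp {n : ℕ} (φ : Euc n → ℝ) (x : Euc n) : Euc n →L[ℝ] Euc n :=
  fderiv ℝ (fun y => gradient φ y) x

/-- The normalized `∞`-Laplacian `⟨D²φ (∇φ/|∇φ|), ∇φ/|∇φ|⟩`. -/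
def infLapN {n : ℕ} (φ : Euc n → ℝ) (x : Euc n) : ℝ :=
  @inner ℝ (Euc n) _ ((hessOp φ x) ((‖gradient φ x‖)⁻¹ • gradient φ x))
    ((‖gradient φ x‖)⁻¹ • gradient φ x)

/-- The normalized `p`-Laplacian `Δφ + (p-2)⟨D²φ (∇φ/|∇φ|), ∇φ/|∇φ|⟩`. -/
def pLapN {n : ℕ} (p : ℝ) (φ : Euc n → ℝ) (x : Euc n) : ℝ :=
  LinearMap.trace ℝ (Euc n) (hessOp φ x : Euc n →ₗ[ℝ] Euc n) + (p - 2) * infLapN φ x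

/-- `ℋ(x,t,ξ) = |ξ|^𝔭 + 𝔞(x,t)|ξ|^𝔮`. -/
def Hop {n : ℕ} (pp qq : ℝ) (a : Euc n × ℝ → ℝ) (z : Euc n × ℝ) (ξ : Euc n) : ℝ :=
  ‖ξ‖ ^ pp + a z * ‖ξ‖ ^ qq

/-- Test functions of class `C^{2,1}`: `C²` in space and `C¹` in time. -/
def IsTestC21 {n : ℕ} (φ : Euc n × ℝ → ℝ) : Prop :=
  (∀ t, ContDiff ℝ 2 fun x => φ (x, t)) ∧ ∀ x, ContDiff ℝ 1 fun s => φ (x, s)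

/-- Viscosity subsolution of `∂ₜ u - G(x,t)[u(·,t)] = f` on `Q`, where the
spatial operator `G` is evaluated on time slices of test functions. -/
def ViscSubsolOp {n : ℕ} (G : Euc n × ℝ → (Euc n → ℝ) → ℝ) (f : Euc n × ℝ → ℝ)
    (Q : Set (Euc n × ℝ)) (u : Euc n × ℝ → ℝ) : Prop :=
  ∀ x₀ : Euc n, ∀ t₀ : ℝ, (x₀, t₀) ∈ Q →
    (∀ φ : Euc n × ℝ → ℝ, IsTestC21 φ →
      IsLocalMaxOn (fun z => u z - φ z) Q (x₀, t₀) →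
      gradient (fun x => φ (x, t₀)) x₀ ≠ 0 →
      deriv (fun s => φ (x₀, s)) t₀ - G (x₀, t₀) (fun x => φ (x, t₀)) ≤ f (x₀, t₀)) ∧
    (∀ δ₁ : ℝ, 0 < δ₁ → ∀ φ : ℝ → ℝ, ContDiff ℝ 1 φ → φ t₀ = 0 →
      (∀ t ∈ Ioo (t₀ - δ₁) (t₀ + δ₁), u (x₀, t) - φ t ≤ u (x₀, t₀)) →
      (∃ ε > 0, ∀ x ∈ ball x₀ ε,
        sSup ((fun t => u (x, t) - φ t) '' Ioo (t₀ - δ₁) (t₀ + δ₁)) =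
          sSup ((fun t => u (x₀, t) - φ t) '' Ioo (t₀ - δ₁) (t₀ + δ₁))) →
      deriv φ t₀ ≤ f (x₀, t₀))

/-- Viscosity supersolution of `∂ₜ u - G(x,t)[u(·,t)] = f` on `Q`. -/
def ViscSupersolOp {n : ℕ} (G : Euc n × ℝ → (Euc n → ℝ) → ℝ) (f : Euc n × ℝ → ℝ)
    (Q : Set (Euc n × ℝ)) (u : Euc n × ℝ → ℝ) : Prop :=
  ∀ x₀ : Euc n, ∀ t₀ : ℝ, (x₀, t₀) ∈ Q →
    (∀ φ : Euc n × ℝ → ℝ, IsTestC21 φ →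
      IsLocalMinOn (fun z => u z - φ z) Q (x₀, t₀) →
      gradient (fun x => φ (x, t₀)) x₀ ≠ 0 →
      f (x₀, t₀) ≤ deriv (fun s => φ (x₀, s)) t₀ - G (x₀, t₀) (fun x => φ (x, t₀))) ∧
    (∀ δ₁ : ℝ, 0 < δ₁ → ∀ φ : ℝ → ℝ, ContDiff ℝ 1 φ → φ t₀ = 0 →
      (∀ t ∈ Ioo (t₀ - δ₁) (t₀ + δ₁), u (x₀, t₀) ≤ u (x₀, t) - φ t) →
      (∃ ε > 0, ∀ x ∈ ball x₀ ε,
        sInf ((fun t => u (x, t) - φ t) '' Ioo (t₀ - δ₁) (t₀ + δ₁)) =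
          sInf ((fun t => u (x₀, t) - φ t) '' Ioo (t₀ - δ₁) (t₀ + δ₁))) →
      f (x₀, t₀) ≤ deriv φ t₀)

/-- Viscosity solution for a general spatial operator. -/
def ViscSolOp {n : ℕ} (G : Euc n × ℝ → (Euc n → ℝ) → ℝ) (f : Euc n × ℝ → ℝ)
    (Q : Set (Euc n × ℝ)) (u : Euc n × ℝ → ℝ) : Prop :=
  ContinuousOn u Q ∧ ViscSubsolOp G f Q u ∧ ViscSupersolOp G f Q u

/-- The spatial operator `ℋ(x,t,∇φ) Δ_p^N φ` of the paper. -/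
def Gpq {n : ℕ} (p pp qq : ℝ) (a : Euc n × ℝ → ℝ) : Euc n × ℝ → (Euc n → ℝ) → ℝ :=
  fun z ψ => Hop pp qq a z (gradient ψ z.1) * pLapN p ψ z.1

/-- Viscosity subsolution of `∂ₜ u - ℋ(x,t,∇u) Δ_p^N u = f` on `Q`. -/
def ViscSubsol {n : ℕ} (p pp qq : ℝ) (a f : Euc n × ℝ → ℝ) (Q : Set (Euc n × ℝ))
    (u : Euc n × ℝ → ℝ) : Prop :=
  ViscSubsolOp (Gpq p pp qq a) f Q u

/-- Viscosity supersolution of `∂ₜ u - ℋ(x,t,∇u) Δ_p^N u = f` on `Q`. -/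
def ViscSupersol {n : ℕ} (p pp qq : ℝ) (a f : Euc n × ℝ → ℝ) (Q : Set (Euc n × ℝ))
    (u : Euc n × ℝ → ℝ) : Prop :=
  ViscSupersolOp (Gpq p pp qq a) f Q u

/-- (Continuous) viscosity solution of `∂ₜ u - ℋ(x,t,∇u) Δ_p^N u = f` on `Q`. -/
def ViscSol {n : ℕ} (p pp qq : ℝ) (a f : Euc n × ℝ → ℝ) (Q : Set (Euc n × ℝ))
    (u : Euc n × ℝ → ℝ) : Prop :=
  ContinuousOn u Q ∧ ViscSubsol p pp qq a f Q u ∧ ViscSupersol p pp qq a f Q u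

/-- The sup of `|g|` over a set (the `L^∞` norm on `Q`). -/
def supAbs {α : Type*} (g : α → ℝ) (Q : Set α) : ℝ :=
  sSup ((fun z => |g z|) '' Q)

/-- The oscillation of `g` over a set. -/
def oscOn {α : Type*} (g : α → ℝ) (Q : Set α) : ℝ :=
  sSup (g '' Q) - sInf (g '' Q)

/-- `g` is bounded on `Q`. -/
def BddOn {α : Type*} (g : α → ℝ) (Q : Set α) : Prop :=
  ∃ M, ∀ z ∈ Q, |g z| ≤ M

/-- Structural hypotheses (H2)–(H3) on the modulating coefficient over `Q₁`. -/
def HypA (n : ℕ) (a : Euc n × ℝ → ℝ) (aminus aplus A0 : ℝ) : Prop :=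
  0 < aminus ∧ (∀ z ∈ Qcyl n 1, aminus ≤ a z ∧ a z ≤ aplus) ∧
    (∀ t ∈ Ioc (-1 : ℝ) 0, ContDiffOn ℝ 1 (fun x => a (x, t)) (ball (0 : Euc n) 1)) ∧
    (∀ x ∈ ball (0 : Euc n) 1, ContDiffOn ℝ 1 (fun s => a (x, s)) (Ioc (-1 : ℝ) 0)) ∧
    ∀ z ∈ Qcyl n 1,
      ‖fderivWithin ℝ (fun x => a (x, z.2)) (ball (0 : Euc n) 1) z.1‖ ≤ A0 ∧
      ‖fderivWithin ℝ (fun s => a (z.1, s)) (Ioc (-1 : ℝ) 0) z.2‖ ≤ A0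

/-- (H4): the source term is continuous and bounded on `Q`. -/
def HypF {n : ℕ} (f : Euc n × ℝ → ℝ) (Q : Set (Euc n × ℝ)) : Prop :=
  ContinuousOn f Q ∧ BddOn f Q

/-- A Lipschitz-in-space bound for the coefficient `𝔞` on `Q`. -/
def LipXBound {n : ℕ} (a : Euc n × ℝ → ℝ) (Q : Set (Euc n × ℝ)) (L : ℝ) : Prop :=
  ∀ x y : Euc n, ∀ t : ℝ, (x, t) ∈ Q → (y, t) ∈ Q → |a (x, t) - a (y, t)| ≤ L * ‖x - y‖

/-- Away from the origin `‖·‖ ^ q` is differentiable for every real exponent `q`. -/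
theorem hasFDerivAt_norm_rpow_of_ne_zero {E : Type*} [NormedAddCommGroup E]
    [InnerProductSpace ℝ E] {x : E} (hx : x ≠ 0) (q : ℝ) :
    HasFDerivAt (fun y : E => ‖y‖ ^ q) ((q * ‖x‖ ^ (q - 2)) • innerSL ℝ x) x := by
  apply HasStrictFDerivAt.hasFDerivAt
  convert! (hasStrictFDerivAt_norm_sq x).rpow_const (p := q / 2) (by simp [hx]) using 0
  simp_rw [← Real.rpow_natCast_mul (norm_nonneg _), ← Nat.cast_smul_eq_nsmul ℝ, smul_smul]
  ring_nf

section PowerProfile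

variable {n : ℕ} {x : Euc n}

theorem gradient_const_mul_norm_rpow_sub (hx : x ≠ 0) (c q t : ℝ) :
    gradient (fun y : Euc n => c * (‖y‖ ^ q - t)) x = (c * q * ‖x‖ ^ (q - 2)) • x := by
  apply HasGradientAt.gradient
  rw [hasGradientAt_iff_hasFDerivAt]
  convert! ((hasFDerivAt_norm_rpow_of_ne_zero hx q).sub_const t).const_mul c using 1
  ext v
  simp only [InnerProductSpace.toDual_apply_apply, inner_smul_left, smul_apply,
    innerSL_apply_apply, smul_eq_mul, RCLike.conj_to_real]
  ring

theorem hessOp_const_mul_norm_rpow_sub (hx : x ≠ 0) (c q t : ℝ) :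
    hessOp (fun y : Euc n => c * (‖y‖ ^ q - t)) x =
      (c * q) • (‖x‖ ^ (q - 2) • ContinuousLinearMap.id ℝ (Euc n) +
        (((q - 2) * ‖x‖ ^ (q - 2 - 2)) • innerSL ℝ x).smulRight x) := by
  have hgrad : (fun y : Euc n => gradient (fun y : Euc n => c * (‖y‖ ^ q - t)) y) =ᶠ[nhds x]
      fun y => (c * q) • (‖y‖ ^ (q - 2) • y) := by
    filter_upwards [isOpen_ne.mem_nhds hx] with y hy
    rw [gradient_const_mul_norm_rpow_sub hy, mul_smul]
  rw [hessOp, hgrad.fderiv_eq]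
  exact (((hasFDerivAt_norm_rpow_of_ne_zero hx (q - 2)).smul (hasFDerivAt_id x)).const_smul
    (c * q)).fderiv

theorem norm_rpow_sub_two_mul_sq (hx : x ≠ 0) (q : ℝ) :
    ‖x‖ ^ (q - 2) * ‖x‖ ^ 2 = ‖x‖ ^ q := by
  rw [← Real.rpow_natCast, ← Real.rpow_add (norm_pos_iff.2 hx)]
  norm_num

theorem trace_hessOp_const_mul_norm_rpow_sub (hx : x ≠ 0) (c q t : ℝ) :
    LinearMap.trace ℝ (Euc n)
        (hessOp (fun y : Euc n => c * (‖y‖ ^ q - t)) x : Euc n →ₗ[ℝ] Euc n) =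
      c * q * ‖x‖ ^ (q - 2) * (n + q - 2) := by
  have hpow := norm_rpow_sub_two_mul_sq hx (q - 2)
  have htr : LinearMap.trace ℝ (Euc n) ((((q - 2) * ‖x‖ ^ (q - 2 - 2)) •
      innerSL ℝ x).smulRight x : Euc n →L[ℝ] Euc n) = (q - 2) * ‖x‖ ^ (q - 2) := by
    refine (LinearMap.trace_smulRight (R := ℝ) (M := Euc n) ((((q - 2) * ‖x‖ ^ (q - 2 - 2)) •
      innerSL ℝ x : Euc n →L[ℝ] ℝ) : Euc n →ₗ[ℝ] ℝ) x).trans ?_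
    simp [← hpow, mul_assoc]
  rw [hessOp_const_mul_norm_rpow_sub hx, ContinuousLinearMap.toLinearMap_smul,
    ContinuousLinearMap.toLinearMap_add, ContinuousLinearMap.toLinearMap_smul, map_smul, map_add,
    map_smul, htr, ContinuousLinearMap.coe_id, LinearMap.trace_id]
  simp only [finrank_euclideanSpace, Fintype.card_fin, smul_eq_mul]
  ring

theorem infLapN_const_mul_norm_rpow_sub (hx : x ≠ 0) {c q : ℝ} (hcq : 0 < c * q) (t : ℝ) :
    infLapN (fun y : Euc n => c * (‖y‖ ^ q - t)) x = c * q * ‖x‖ ^ (q - 2) * (q - 1) := by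
  have hr : 0 < ‖x‖ := norm_pos_iff.2 hx
  have hpow := norm_rpow_sub_two_mul_sq hx (q - 2)
  have hm : 0 < c * q * ‖x‖ ^ (q - 2) := mul_pos hcq (Real.rpow_pos_of_pos hr _)
  have hdir : ‖gradient (fun y : Euc n => c * (‖y‖ ^ q - t)) x‖⁻¹ •
      gradient (fun y : Euc n => c * (‖y‖ ^ q - t)) x = ‖x‖⁻¹ • x := by
    rw [gradient_const_mul_norm_rpow_sub hx, norm_smul, Real.norm_of_nonneg hm.le, smul_smul]
    congr 1
    field_simp
    exact div_self hcq.ne'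
  rw [infLapN, hdir, hessOp_const_mul_norm_rpow_sub hx]
  simp only [smul_apply, add_apply,
    ContinuousLinearMap.id_apply, ContinuousLinearMap.smulRight_apply, innerSL_apply_apply,
    inner_smul_left, inner_smul_right, inner_add_left, real_inner_self_eq_norm_sq, smul_eq_mul,
    RCLike.conj_to_real, ← hpow]
  field_simp
  ring

theorem pLapN_const_mul_norm_rpow_sub (hx : x ≠ 0) {c q : ℝ} (hcq : 0 < c * q) (p t : ℝ) :
    pLapN p (fun y : Euc n => c * (‖y‖ ^ q - t)) x =
      c * q * ‖x‖ ^ (q - 2) * (n - 1 + (q - 1) * (p - 1)) := by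
  rw [pLapN, trace_hessOp_const_mul_norm_rpow_sub hx, infLapN_const_mul_norm_rpow_sub hx hcq]
  ring

end PowerProfile

/-- If `α (1 + pp) = 1`, the flux `(K r ^ α) ^ s` times `K r ^ (α - 1)` is controlled by
`2 ^ (1 + qq) * c` for all exponents `pp ≤ s ≤ qq`. -/
theorem rpow_mul_barrier_le {pp qq s α c K r : ℝ} (hpp : 0 ≤ pp) (hps : pp ≤ s) (hsq : s ≤ qq)
    (hα0 : 0 < α) (hα : α * (1 + pp) = 1) (hc0 : 0 < c) (hc1 : c ≤ 1) (hK0 : 0 < K)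
    (hK : K ≤ 2 * c) (hr0 : 0 < r) (hr1 : r ≤ 1) :
    (K * r ^ α) ^ s * (K * r ^ (α - 1)) ≤ (2 : ℝ) ^ (1 + qq) * c := by
  have hsplit : (K * r ^ α) ^ s * (K * r ^ (α - 1)) = K ^ (1 + s) * r ^ (α * s + (α - 1)) := by
    rw [Real.mul_rpow hK0.le (Real.rpow_nonneg hr0.le _), ← Real.rpow_mul hr0.le,
      Real.rpow_add hK0, Real.rpow_add hr0, Real.rpow_one]
    ring
  have hexp : 0 ≤ α * s + (α - 1) := by nlinarith
  have hr : r ^ (α * s + (α - 1)) ≤ 1 := Real.rpow_le_one hr0.le hr1 hexp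
  have hcpow : c ^ (1 + s) ≤ c := by
    simpa using Real.rpow_le_rpow_of_exponent_ge hc0 hc1 (by linarith : (1 : ℝ) ≤ 1 + s)
  calc (K * r ^ α) ^ s * (K * r ^ (α - 1))
      = K ^ (1 + s) * r ^ (α * s + (α - 1)) := hsplit
    _ ≤ K ^ (1 + s) := mul_le_of_le_one_right (Real.rpow_nonneg hK0.le _) hr
    _ ≤ (2 * c) ^ (1 + s) := Real.rpow_le_rpow hK0.le hK (by linarith)
    _ = 2 ^ (1 + s) * c ^ (1 + s) := Real.mul_rpow zero_le_two hc0.le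
    _ ≤ 2 ^ (1 + qq) * c := by
      gcongr
      norm_num

/-- barrier computation in the proof of Theorem 1.3: the
function `Φ(x,t) = 𝔠(|x|^{1+α} - t)` is a classical strict supersolution. -/
theorem barrier_supersolution_inequality
    (n : ℕ) (hn : 1 ≤ n) (p : ℝ) (hp : 1 < p) (pp qq : ℝ) (hpp : 0 ≤ pp) (hpq : pp ≤ qq)
    (a : Euc n × ℝ → ℝ) (aplus : ℝ)
    (ha : ∀ z : Euc n × ℝ, ‖z.1‖ ≤ 1 → z.2 < 0 → 0 ≤ a z ∧ a z ≤ aplus)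
    (c₀ : ℝ) (hc₀ : c₀ < 0) (c : ℝ) (hc : c ∈ Ioc (0 : ℝ) 1)
    (hcsmall : c ≤ |c₀| /
      (1 + (2 : ℝ) ^ (1 + qq) * (1 + aplus) * ((n : ℝ) - 1 + (1 / (1 + pp)) * (p - 1)))) :
    let α : ℝ := 1 / (1 + pp)
    let Φ : Euc n × ℝ → ℝ := fun z => c * (‖z.1‖ ^ (1 + α) - z.2)
    ∀ x : Euc n, ∀ t : ℝ, 0 < ‖x‖ → ‖x‖ ≤ 1 → t < 0 →
      gradient (fun y => Φ (y, t)) x = (c * (1 + α) * ‖x‖ ^ (α - 1)) • x ∧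
      gradient (fun y => Φ (y, t)) x ≠ 0 ∧
      pLapN p (fun y => Φ (y, t)) x =
        c * (1 + α) * ‖x‖ ^ (α - 1) * ((n : ℝ) - 1 + α * (p - 1)) ∧
      c₀ ≤ deriv (fun s => Φ (x, s)) t -
        Hop pp qq a (x, t) (gradient (fun y => Φ (y, t)) x) *
          pLapN p (fun y => Φ (y, t)) x := by
  intro α Φ x t hr0 hr1 ht
  obtain ⟨hc0, hc1⟩ := hc
  have hx : x ≠ 0 := norm_pos_iff.1 hr0
  have hα0 : 0 < α := by positivity
  have hα : α * (1 + pp) = 1 := one_div_mul_cancel (by positivity)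
  have hα1 : α ≤ 1 := by nlinarith
  have hK0 : 0 < c * (1 + α) := by positivity
  have hgrad : gradient (fun y => Φ (y, t)) x = (c * (1 + α) * ‖x‖ ^ (α - 1)) • x := by
    rw [gradient_const_mul_norm_rpow_sub hx]
    ring_nf
  have hlap : pLapN p (fun y => Φ (y, t)) x =
      c * (1 + α) * ‖x‖ ^ (α - 1) * ((n : ℝ) - 1 + α * (p - 1)) := by
    rw [pLapN_const_mul_norm_rpow_sub hx hK0]
    ring_nf
  have hm : 0 < c * (1 + α) * ‖x‖ ^ (α - 1) := by positivity
  have hderiv : deriv (fun s => Φ (x, s)) t = -c := by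
    refine (((hasDerivAt_id t).const_sub (‖x‖ ^ (1 + α))).const_mul c).deriv.trans ?_
    ring
  have hnorm : ‖(c * (1 + α) * ‖x‖ ^ (α - 1)) • x‖ = c * (1 + α) * ‖x‖ ^ α := by
    rw [norm_smul, Real.norm_of_nonneg hm.le, mul_assoc, ← Real.rpow_add_one hr0.ne',
      sub_add_cancel]
  refine ⟨hgrad, ?_, hlap, ?_⟩
  · rw [hgrad]
    exact smul_ne_zero hm.ne' hx
  obtain ⟨ha0, ha1⟩ := ha (x, t) hr1 ht
  have hn1 : (1 : ℝ) ≤ n := by exact_mod_cast hn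
  have hS : 0 ≤ (n : ℝ) - 1 + α * (p - 1) :=
    add_nonneg (by linarith) (mul_nonneg hα0.le (by linarith))
  have hK : c * (1 + α) ≤ 2 * c := by nlinarith
  have hlow := rpow_mul_barrier_le hpp le_rfl hpq hα0 hα hc0 hc1 hK0 hK hr0 hr1
  have hhigh := rpow_mul_barrier_le hpp hpq le_rfl hα0 hα hc0 hc1 hK0 hK hr0 hr1
  have hflux : ((c * (1 + α) * ‖x‖ ^ α) ^ pp + a (x, t) * (c * (1 + α) * ‖x‖ ^ α) ^ qq) *
      (c * (1 + α) * ‖x‖ ^ (α - 1)) ≤ 2 ^ (1 + qq) * c * (1 + aplus) := by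
    have h := mul_le_mul ha1 hhigh (by positivity) (ha0.trans ha1)
    linarith
  rw [le_div_iff₀ (by have := ha0.trans ha1; positivity), abs_of_neg hc₀] at hcsmall
  rw [hderiv, hlap, hgrad, Hop, hnorm]
  have h := mul_le_mul_of_nonneg_right hflux hS
  linarith

end
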